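/- Fix m ≥ 1 and let μ, ν, ρ be Borel probability measures on ℝ^m (functions from Fin m to ℝ) with finite second moments, i.e., ∫ ‖x‖² dμ(x) < ∞ and similarly for ν and ρ. Define HSWD(μ,ν) = ((1/m) Σ_{l=1}^m W(π_l#μ, π_l#ν)²)^{1/2}, where π_l is the l-th coordinate projection, π_l#μ denotes the pushforward of μ under π_l, and W is the one-dimensional Wasserstein-2 distance W(α,β) = (∫₀¹ (Q_α(t) − Q_β(t))² dt)^{1/2}. Then HSWD satisfies the triangle inequality: HSWD(μ,ρ) ≤ HSWD(μ,ν) + HSWD(ν,ρ). -/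

import Mathlib

open MeasureTheory Set

/-- Cumulative distribution function of a measure on ℝ: `F_μ(x) = μ((−∞, x])`. -/
noncomputable def cdfFn (μ : Measure ℝ) (x : ℝ) : ℝ := (μ (Iic x)).toReal

/-- Quantile function of a measure on ℝ: `Q_μ(t) = inf {x | t ≤ F_μ(x)}`. -/
noncomputable def quantileFn (μ : Measure ℝ) (t : ℝ) : ℝ := sInf {x : ℝ | t ≤ cdfFn μ x}

/-- The one-dimensional Wasserstein-2 distance between measures on ℝ, given in closed form
via quantile functions: `W(μ,ν) = (∫₀¹ (Q_μ(t) − Q_ν(t))² dt)^{1/2}`. -/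
noncomputable def W2 (μ ν : Measure ℝ) : ℝ :=
  Real.sqrt (∫ t in Ioo (0 : ℝ) 1, (quantileFn μ t - quantileFn ν t) ^ 2)

/-- The HSWD distance between measures on `ℝ^m`: the root-mean-square of the one-dimensional
Wasserstein-2 distances between the coordinate marginals,
`HSWD(μ,ν) = ((1/m) Σ_l W(π_l#μ, π_l#ν)²)^{1/2}`. -/
noncomputable def HSWD (m : ℕ) (μ ν : Measure (Fin m → ℝ)) : ℝ :=
  Real.sqrt ((1 / (m : ℝ)) *
    ∑ l : Fin m, (W2 (Measure.map (fun x => x l) μ) (Measure.map (fun x => x l) ν)) ^ 2)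

/-- The Galois connection between the quantile function and the distribution function. -/
theorem quantileFn_le_iff (α : Measure ℝ) [IsProbabilityMeasure α] {t : ℝ}
    (ht : t ∈ Ioo (0 : ℝ) 1) (x : ℝ) : quantileFn α t ≤ x ↔ t ≤ cdfFn α x := by
  have hcdf : cdfFn α = ProbabilityTheory.cdf α := by
    ext x; rw [ProbabilityTheory.cdf_eq_real]; rfl
  unfold quantileFn
  rw [hcdf]
  constructor
  · intro h
    obtain ⟨y, hy⟩ := ((ProbabilityTheory.tendsto_cdf_atTop α).eventually_const_lt ht.2).exists
    have hright : Filter.Tendsto (ProbabilityTheory.cdf α) (nhdsWithin x (Ioi x))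
        (nhds (ProbabilityTheory.cdf α x)) :=
      ((ProbabilityTheory.cdf α).right_continuous x).mono_left (nhdsWithin_mono _ Ioi_subset_Ici_self)
    refine ge_of_tendsto hright ?_
    filter_upwards [self_mem_nhdsWithin] with z hz
    obtain ⟨w, hw, hwz⟩ := exists_lt_of_csInf_lt ⟨y, hy.le⟩ (lt_of_le_of_lt h hz)
    exact le_trans hw (ProbabilityTheory.monotone_cdf α hwz.le)
  · intro h
    obtain ⟨y, hy⟩ := ((ProbabilityTheory.tendsto_cdf_atBot α).eventually_lt_const ht.1).exists
    refine csInf_le ⟨y, fun z hz => ?_⟩ h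
    by_contra! hzy
    exact absurd (le_trans hz (ProbabilityTheory.monotone_cdf α hzy.le)) (not_le.2 hy)

theorem aemeasurable_quantileFn (α : Measure ℝ) [IsProbabilityMeasure α] :
    AEMeasurable (quantileFn α) (volume.restrict (Ioo (0 : ℝ) 1)) := by
  refine aemeasurable_restrict_of_monotoneOn measurableSet_Ioo fun s hs t ht hst => ?_
  exact (quantileFn_le_iff α hs _).2 (hst.trans ((quantileFn_le_iff α ht _).1 le_rfl))

/-- The quantile function pushes the uniform measure on `(0, 1)` forward to the measure. -/
theorem map_quantileFn (α : Measure ℝ) [IsProbabilityMeasure α] :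
    Measure.map (quantileFn α) (volume.restrict (Ioo (0 : ℝ) 1)) = α := by
  refine Measure.ext_of_Iic _ _ fun x => ?_
  have hle : cdfFn α x ≤ 1 := measureReal_le_one
  rw [Measure.map_apply_of_aemeasurable (aemeasurable_quantileFn α) measurableSet_Iic,
    Measure.restrict_apply' measurableSet_Ioo]
  have hset : quantileFn α ⁻¹' Iic x ∩ Ioo 0 1 = Iic (cdfFn α x) ∩ Ioo 0 1 := by
    ext t
    simp only [mem_inter_iff, mem_preimage, mem_Iic]
    exact and_congr_left fun ht => quantileFn_le_iff α ht x
  have hae : (Iic (cdfFn α x) ∩ Ioo 0 1 : Set ℝ) =ᵐ[volume]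
      (Iic (cdfFn α x) ∩ Ioc 0 1 : Set ℝ) :=
    (Filter.EventuallyEq.refl _ _).inter Ioo_ae_eq_Ioc
  rw [hset, measure_congr hae, inter_comm, Ioc_inter_Iic, inf_eq_right.2 hle, Real.volume_Ioc,
    sub_zero]
  exact ENNReal.ofReal_toReal (measure_ne_top _ _)

theorem memLp_quantileFn {α : Measure ℝ} [IsProbabilityMeasure α] (h : MemLp id 2 α) :
    MemLp (quantileFn α) 2 (volume.restrict (Ioo (0 : ℝ) 1)) := by
  rw [← map_quantileFn α] at h
  exact h.comp_of_map (aemeasurable_quantileFn α)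

theorem W2_eq_eLpNorm {α β : Measure ℝ} [IsProbabilityMeasure α] [IsProbabilityMeasure β]
    (hα : MemLp id 2 α) (hβ : MemLp id 2 β) :
    W2 α β = (eLpNorm (quantileFn α - quantileFn β) 2
      (volume.restrict (Ioo (0 : ℝ) 1))).toReal := by
  rw [((memLp_quantileFn hα).sub (memLp_quantileFn hβ)).eLpNorm_eq_integral_rpow_norm
    two_ne_zero ENNReal.ofNat_ne_top, ENNReal.toReal_ofReal (by positivity), W2, Real.sqrt_eq_rpow]
  simp

/-- Triangle inequality for the one-dimensional Wasserstein-2 distance. -/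
theorem W2_triangle {α β γ : Measure ℝ} [IsProbabilityMeasure α] [IsProbabilityMeasure β]
    [IsProbabilityMeasure γ] (hα : MemLp id 2 α) (hβ : MemLp id 2 β) (hγ : MemLp id 2 γ) :
    W2 α γ ≤ W2 α β + W2 β γ := by
  have hαβ := (memLp_quantileFn hα).sub (memLp_quantileFn hβ)
  have hβγ := (memLp_quantileFn hβ).sub (memLp_quantileFn hγ)
  rw [W2_eq_eLpNorm hα hγ, W2_eq_eLpNorm hα hβ, W2_eq_eLpNorm hβ hγ,
    ← ENNReal.toReal_add hαβ.eLpNorm_ne_top hβγ.eLpNorm_ne_top,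
    ← sub_add_sub_cancel (quantileFn α) (quantileFn β) (quantileFn γ)]
  exact ENNReal.toReal_mono (ENNReal.add_ne_top.2 ⟨hαβ.eLpNorm_ne_top, hβγ.eLpNorm_ne_top⟩)
    (eLpNorm_add_le hαβ.aestronglyMeasurable hβγ.aestronglyMeasurable one_le_two)

/-- Coordinate marginals of a measure with finite second moment have finite second moment. -/
theorem memLp_id_map_eval {m : ℕ} {μ : Measure (Fin m → ℝ)}
    (hμ : Integrable (fun x : Fin m → ℝ => ‖x‖ ^ 2) μ) (l : Fin m) :
    MemLp id 2 (Measure.map (fun x : Fin m → ℝ => x l) μ) := by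
  have hid : MemLp (fun x : Fin m → ℝ => x) 2 μ :=
    (memLp_two_iff_integrable_sq_norm aestronglyMeasurable_id).2 hμ
  have hl : Measurable fun x : Fin m → ℝ => x l := measurable_pi_apply l
  exact (memLp_map_measure_iff aestronglyMeasurable_id hl.aemeasurable).2 <|
    hid.mono hl.aestronglyMeasurable (Filter.Eventually.of_forall fun x => norm_le_pi_norm x l)

/-- Minkowski's inequality in `ℝ^ι` for a family dominated by a sum of two families. -/
theorem sqrt_sum_sq_le_of_le_add {ι : Type*} [Fintype ι] {a b c : ι → ℝ} (ha : ∀ i, 0 ≤ a i)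
    (h : ∀ i, a i ≤ b i + c i) :
    √(∑ i, a i ^ 2) ≤ √(∑ i, b i ^ 2) + √(∑ i, c i ^ 2) := by
  calc √(∑ i, a i ^ 2) ≤ √(∑ i, (b i + c i) ^ 2) :=
        Real.sqrt_le_sqrt (Finset.sum_le_sum fun i _ => pow_le_pow_left₀ (ha i) (h i) 2)
    _ ≤ √(∑ i, b i ^ 2) + √(∑ i, c i ^ 2) := by
        simpa [EuclideanSpace.norm_eq] using norm_add_le (WithLp.toLp 2 b) (WithLp.toLp 2 c)

/-- Triangle inequality for HSWD on Borel probability measures on `ℝ^m` with finite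
second moments. -/
theorem HSWD_triangle (m : ℕ) (hm : 1 ≤ m) (μ ν ρ : Measure (Fin m → ℝ))
    [IsProbabilityMeasure μ] [IsProbabilityMeasure ν] [IsProbabilityMeasure ρ]
    (hμ : Integrable (fun x : Fin m → ℝ => ‖x‖ ^ 2) μ)
    (hν : Integrable (fun x : Fin m → ℝ => ‖x‖ ^ 2) ν)
    (hρ : Integrable (fun x : Fin m → ℝ => ‖x‖ ^ 2) ρ) :
    HSWD m μ ρ ≤ HSWD m μ ν + HSWD m ν ρ := by
  have hmap (μ : Measure (Fin m → ℝ)) [IsProbabilityMeasure μ] (l : Fin m) :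
      IsProbabilityMeasure (Measure.map (fun x => x l) μ) :=
    Measure.isProbabilityMeasure_map (measurable_pi_apply l).aemeasurable
  have hm_inv : (0 : ℝ) ≤ 1 / m := by positivity
  simp only [HSWD, Real.sqrt_mul hm_inv]
  rw [← mul_add]
  refine mul_le_mul_of_nonneg_left
    (sqrt_sum_sq_le_of_le_add (fun _ => Real.sqrt_nonneg _) fun l => ?_) (Real.sqrt_nonneg _)
  exact W2_triangle (memLp_id_map_eval hμ l) (memLp_id_map_eval hν l) (memLp_id_map_eval hρ l)
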